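/- Let R be a graded commutative ring and suppose c ∈ ℚ[x₁,…,xₙ]/S (S the ideal of symmetric polynomials of positive degree) is such that c·m = 0 for every non-constant monomial m in x₁,…,xₙ. Then c lies in the one-dimensional top-degree component spanned by the class of ∏_{i=2}^{n} x_i^{i-1} (the class of a point). -/

import Mathlib

open MvPolynomial

/-- The ideal of `ℚ[σ]` generated by the symmetric polynomials with zero constant term. -/
noncomputable abbrev symmetricIdeal (σ : Type*) : Ideal (MvPolynomial σ ℚ) :=
  Ideal.span {p : MvPolynomial σ ℚ | p.IsSymmetric ∧ constantCoeff p = 0}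

section Antisymmetry

variable {σ : Type*}

lemma rename_mem_symmetricIdeal (e : Equiv.Perm σ) {f : MvPolynomial σ ℚ}
    (hf : f ∈ symmetricIdeal σ) : rename e f ∈ symmetricIdeal σ := by
  induction hf using Submodule.span_induction with
  | mem p hp => rw [hp.1 e]; exact Ideal.subset_span hp
  | zero => simp
  | add p q _ _ hp hq => rw [map_add]; exact add_mem hp hq
  | smul a p _ hp => rw [smul_eq_mul, map_mul]; exact Ideal.mul_mem_left _ _ hp

variable [DecidableEq σ]

lemma X_sub_X_dvd_sub_rename_swap (i j : σ) (f : MvPolynomial σ ℚ) :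
    (X i - X j : MvPolynomial σ ℚ) ∣ f - rename (Equiv.swap i j) f := by
  rw [← Ideal.mem_span_singleton, ← Ideal.Quotient.mk_eq_mk_iff_sub_mem]
  set J : Ideal (MvPolynomial σ ℚ) := Ideal.span {X i - X j}
  have hij : Ideal.Quotient.mk J (X i) = Ideal.Quotient.mk J (X j) :=
    (Ideal.Quotient.mk_eq_mk_iff_sub_mem _ _).2 (Ideal.mem_span_singleton_self _)
  have h : (Ideal.Quotient.mkₐ ℚ J) =
      (Ideal.Quotient.mkₐ ℚ J).comp (rename (Equiv.swap i j)) := by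
    ext k
    simp only [AlgHom.comp_apply, rename_X, Ideal.Quotient.mkₐ_eq_mk, Equiv.swap_apply_def]
    split_ifs with h₁ h₂
    · rw [h₁, hij]
    · rw [h₂, hij]
    · rfl
  exact DFunLike.congr_fun h f

/-- The divided differences preserve the ideal `symmetricIdeal σ`. -/
lemma exists_sub_rename_swap_eq_mul (i j : σ) {f : MvPolynomial σ ℚ}
    (hf : f ∈ symmetricIdeal σ) :
    ∃ g ∈ symmetricIdeal σ, f - rename (Equiv.swap i j) f = (X i - X j) * g := by
  induction hf using Submodule.span_induction with
  | mem p hp => exact ⟨0, zero_mem _, by rw [hp.1]; simp⟩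
  | zero => exact ⟨0, zero_mem _, by simp⟩
  | add p q _ _ hp hq =>
    obtain ⟨g, hg, hpg⟩ := hp
    obtain ⟨h, hh, hqh⟩ := hq
    exact ⟨g + h, add_mem hg hh, by rw [map_add]; linear_combination hpg + hqh⟩
  | smul a p hp' hp =>
    obtain ⟨g, hg, hpg⟩ := hp
    obtain ⟨b, hb⟩ := X_sub_X_dvd_sub_rename_swap i j a
    refine ⟨b * p + rename (Equiv.swap i j) a * g,
      add_mem (Ideal.mul_mem_left _ _ hp') (Ideal.mul_mem_left _ _ hg), ?_⟩
    rw [smul_eq_mul, map_mul]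
    linear_combination p * hb + rename (Equiv.swap i j) a * hpg

lemma add_rename_swap_mem_symmetricIdeal {i j : σ} (hij : i ≠ j) {f : MvPolynomial σ ℚ}
    (hi : X i * f ∈ symmetricIdeal σ) (hj : X j * f ∈ symmetricIdeal σ) :
    f + rename (Equiv.swap i j) f ∈ symmetricIdeal σ := by
  obtain ⟨g, hg⟩ := X_sub_X_dvd_sub_rename_swap i j f
  obtain ⟨a, ha, hai⟩ := exists_sub_rename_swap_eq_mul i j hi
  obtain ⟨b, hb, hbj⟩ := exists_sub_rename_swap_eq_mul i j hj
  have hne : (X i - X j : MvPolynomial σ ℚ) ≠ 0 :=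
    sub_ne_zero.2 fun h => hij (X_injective h)
  rw [map_mul, rename_X, Equiv.swap_apply_left] at hai
  rw [map_mul, rename_X, Equiv.swap_apply_right] at hbj
  have h₁ : f + X j * g = a := mul_left_cancel₀ hne (by linear_combination hai - X j * hg)
  have h₂ : X i * g - f = b := mul_left_cancel₀ hne (by linear_combination hbj - X i * hg)
  have h : f + rename (Equiv.swap i j) f = a - b := by
    linear_combination h₁ - h₂ - hg
  exact h ▸ sub_mem ha hb

variable [Fintype σ]

/-- A socle element of the coinvariant algebra transforms by the sign character. -/
lemma rename_sub_sign_smul_mem_symmetricIdeal {f : MvPolynomial σ ℚ}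
    (hf : ∀ i, X i * f ∈ symmetricIdeal σ) (e : Equiv.Perm σ) :
    rename e f - (Equiv.Perm.sign e : ℤ) • f ∈ symmetricIdeal σ := by
  induction e using Equiv.Perm.swap_induction_on with
  | one => simp
  | swap_mul e i j hij ih =>
    have h := rename_mem_symmetricIdeal (Equiv.swap i j) ih
    have h' := Submodule.smul_of_tower_mem (symmetricIdeal σ) (Equiv.Perm.sign e : ℤ)
      (add_rename_swap_mem_symmetricIdeal hij (hf i) (hf j))
    convert add_mem h h' using 1
    rw [map_sub, map_zsmul, rename_rename, Equiv.Perm.sign_mul, Equiv.Perm.sign_swap hij,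
      Equiv.Perm.coe_mul]
    simp only [Units.val_neg, neg_mul, one_mul, neg_smul, smul_add]
    abel

/-- The antisymmetrization operator. -/
noncomputable def antisymmetrize : MvPolynomial σ ℚ →ₗ[ℚ] MvPolynomial σ ℚ :=
  ∑ e : Equiv.Perm σ, (Equiv.Perm.sign e : ℤ) • (rename e : _ →ₐ[ℚ] _).toLinearMap

lemma antisymmetrize_apply (f : MvPolynomial σ ℚ) :
    antisymmetrize f = ∑ e : Equiv.Perm σ, (Equiv.Perm.sign e : ℤ) • rename e f := by
  simp [antisymmetrize, LinearMap.sum_apply]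

lemma antisymmetrize_eq_zero {i j : σ} (hij : i ≠ j) {f : MvPolynomial σ ℚ}
    (hf : rename (Equiv.swap i j) f = f) : antisymmetrize f = 0 := by
  have h : antisymmetrize f = -antisymmetrize f := by
    conv_lhs => rw [antisymmetrize_apply, ← Equiv.sum_comp (Equiv.mulRight (Equiv.swap i j))]
    rw [antisymmetrize_apply, ← Finset.sum_neg_distrib]
    refine Finset.sum_congr rfl fun e _ => ?_
    rw [Equiv.coe_mulRight, Equiv.Perm.sign_mul, Equiv.Perm.sign_swap hij, Equiv.Perm.coe_mul,
      ← rename_rename, hf]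
    simp
  exact self_eq_neg.1 h

lemma antisymmetrize_sub_factorial_smul_mem {f : MvPolynomial σ ℚ}
    (hf : ∀ i, X i * f ∈ symmetricIdeal σ) :
    antisymmetrize f - (Fintype.card σ).factorial • f ∈ symmetricIdeal σ := by
  have h : antisymmetrize f - (Fintype.card σ).factorial • f =
      ∑ e : Equiv.Perm σ, (Equiv.Perm.sign e : ℤ) •
        (rename e f - (Equiv.Perm.sign e : ℤ) • f) := by
    simp only [smul_sub, smul_smul, ← Units.val_mul, Int.units_mul_self, Finset.sum_sub_distrib,
      antisymmetrize_apply]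
    simp [Fintype.card_perm]
  rw [h]
  exact sum_mem fun e _ => Submodule.smul_of_tower_mem _ _
    (rename_sub_sign_smul_mem_symmetricIdeal hf e)

end Antisymmetry

section Staircase

variable {n : ℕ}

lemma esymm_mem_symmetricIdeal {σ : Type*} [Fintype σ] {k : ℕ} (hk : k ≠ 0) :
    esymm σ ℚ k ∈ symmetricIdeal σ := by
  refine Ideal.subset_span ⟨esymm_isSymmetric σ ℚ k, ?_⟩
  rw [esymm, map_sum]
  refine Finset.sum_eq_zero fun s hs => ?_
  rw [map_prod]
  obtain ⟨i, hi⟩ := Finset.card_ne_zero.1 ((Finset.mem_powersetCard.1 hs).2.trans_ne hk)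
  exact Finset.prod_eq_zero hi (by simp)

lemma prod_X_add_C_eq_X_pow_of_symmetricIdeal_le {σ A : Type*} [Fintype σ] [CommRing A]
    (φ : MvPolynomial σ ℚ →+* A) (hφ : symmetricIdeal σ ≤ RingHom.ker φ) :
    ∏ i : σ, (Polynomial.X + Polynomial.C (φ (X i))) =
      (Polynomial.X : Polynomial A) ^ Fintype.card σ := by
  have h := congrArg (Polynomial.map φ) (prod_C_add_X_eq_sum_esymm ℚ σ)
  rw [Polynomial.map_prod, Polynomial.map_sum, Finset.sum_eq_single 0] at h
  · simpa using h
  · intro k _ hk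
    have : φ (esymm σ ℚ k) = 0 := hφ (esymm_mem_symmetricIdeal hk)
    simp [this]
  · simp

/-- Modulo the later variables and the symmetric polynomials, `X j ^ (j + 1)` vanishes. -/
lemma X_pow_mem_sup (j : Fin n) :
    (X j ^ (j + 1 : ℕ) : MvPolynomial (Fin n) ℚ) ∈
      symmetricIdeal (Fin n) ⊔ Ideal.span (X '' Set.Ioi j) := by
  set J := symmetricIdeal (Fin n) ⊔ Ideal.span (X '' Set.Ioi j)
  have h := prod_X_add_C_eq_X_pow_of_symmetricIdeal_le (Ideal.Quotient.mk J)
    (by rw [Ideal.mk_ker]; exact le_sup_left)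
  have hlast : ∏ i : Fin n with ¬ i ≤ j,
      (Polynomial.X + Polynomial.C (Ideal.Quotient.mk J (X i))) =
        Polynomial.X ^ (n - (j + 1)) := by
    have hc : (Finset.univ.filter fun i : Fin n => ¬ i ≤ j).card = n - (j + 1) := by
      have : (Finset.univ.filter fun i : Fin n => ¬ i ≤ j) = Finset.Ioi j := by ext; simp
      rw [this, Fin.card_Ioi]; omega
    rw [← hc]
    refine Finset.prod_eq_pow_card fun i hi => ?_
    have : Ideal.Quotient.mk J (X i) = 0 := Ideal.Quotient.eq_zero_iff_mem.2
      (Ideal.mem_sup_right (Ideal.subset_span ⟨i, by simpa using hi, rfl⟩))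
    rw [this, map_zero, add_zero]
  have hpow : (Polynomial.X : Polynomial (MvPolynomial (Fin n) ℚ ⧸ J)) ^ n =
      Polynomial.X ^ (j + 1 : ℕ) * Polynomial.X ^ (n - (j + 1)) := by
    rw [← pow_add, Nat.add_sub_cancel' j.isLt]
  rw [← Finset.prod_filter_mul_prod_filter_not Finset.univ (· ≤ j), hlast, Fintype.card_fin,
    hpow] at h
  have h' := congrArg (Polynomial.eval (-Ideal.Quotient.mk J (X j)))
    ((Polynomial.monic_X_pow _).isRegular.right h)
  rw [Polynomial.eval_prod, Finset.prod_eq_zero (i := j) (by simp) (by simp),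
    Polynomial.eval_pow, Polynomial.eval_X, ← map_neg, ← map_pow] at h'
  have hmem := Ideal.Quotient.eq_zero_iff_mem.1 h'.symm
  rw [neg_pow] at hmem
  exact (Ideal.unit_mul_mem_iff_mem _ (isUnit_one.neg.pow _)).1 hmem

/-- The exponent of the point class. -/
noncomputable def staircase (n : ℕ) : Fin n →₀ ℕ := Finsupp.equivFunOnFinite.symm fun i => i

lemma monomial_staircase : monomial (staircase n) (1 : ℚ) = ∏ i : Fin n, X i ^ (i : ℕ) := by
  rw [monomial_eq, Finsupp.prod_fintype _ _ (by simp)]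
  simp [staircase]

lemma X_mul_prod_Ici_mem (j : Fin n) :
    (X j * ∏ i ∈ Finset.Ici j, X i ^ (i : ℕ) : MvPolynomial (Fin n) ℚ) ∈
      symmetricIdeal (Fin n) := by
  induction hm : n - (j : ℕ) using Nat.strong_induction_on generalizing j with
  | _ m ih =>
    obtain ⟨a, ha, b, hb, hab⟩ := Submodule.mem_sup.1 (X_pow_mem_sup j)
    have hprod : (X j * ∏ i ∈ Finset.Ici j, X i ^ (i : ℕ) : MvPolynomial (Fin n) ℚ) =
        a * ∏ i ∈ Finset.Ioi j, X i ^ (i : ℕ) + b * ∏ i ∈ Finset.Ioi j, X i ^ (i : ℕ) := by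
      rw [← Finset.Ioi_insert, Finset.prod_insert (by simp), ← add_mul, hab]
      ring
    rw [hprod]
    refine add_mem (Ideal.mul_mem_right _ _ ha) ?_
    clear hab hprod
    induction hb using Submodule.span_induction with
    | mem p hp =>
      obtain ⟨k, hk, rfl⟩ := hp
      have hk : j < k := hk
      have h := ih (n - k) (by omega) k rfl
      refine Ideal.mem_of_dvd _ (mul_dvd_mul_left _ (Finset.prod_dvd_prod_of_subset _ _ _ ?_)) h
      intro i hi
      simp only [Finset.mem_Ici, Finset.mem_Ioi] at hi ⊢
      exact hk.trans_le hi
    | zero => simp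
    | add p q _ _ hp hq => rw [add_mul]; exact add_mem hp hq
    | smul r p _ hp => rw [smul_eq_mul, mul_assoc]; exact Ideal.mul_mem_left _ _ hp

lemma X_mul_monomial_staircase_mem (j : Fin n) :
    X j * monomial (staircase n) (1 : ℚ) ∈ symmetricIdeal (Fin n) := by
  rw [monomial_staircase]
  exact Ideal.mem_of_dvd _ (mul_dvd_mul_left _
    (Finset.prod_dvd_prod_of_subset _ _ _ (Finset.subset_univ _))) (X_mul_prod_Ici_mem j)

/-- The polynomials whose class in the coinvariant algebra is a multiple of the point class. -/
noncomputable def pointSpan (n : ℕ) : Submodule ℚ (MvPolynomial (Fin n) ℚ) :=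
  (symmetricIdeal (Fin n)).restrictScalars ℚ ⊔ ℚ ∙ monomial (staircase n) (1 : ℚ)

lemma mem_pointSpan_of_mem {f : MvPolynomial (Fin n) ℚ} (hf : f ∈ symmetricIdeal (Fin n)) :
    f ∈ pointSpan n :=
  Submodule.mem_sup_left hf

lemma rename_mem_pointSpan (e : Equiv.Perm (Fin n)) {f : MvPolynomial (Fin n) ℚ}
    (hf : f ∈ pointSpan n) : rename e f ∈ pointSpan n := by
  obtain ⟨a, ha, b, hb, rfl⟩ := Submodule.mem_sup.1 hf
  obtain ⟨r, rfl⟩ := Submodule.mem_span_singleton.1 hb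
  rw [map_add, map_smul]
  refine add_mem (mem_pointSpan_of_mem (rename_mem_symmetricIdeal e ha))
    (Submodule.smul_mem _ _ ?_)
  have h := mem_pointSpan_of_mem
    (rename_sub_sign_smul_mem_symmetricIdeal X_mul_monomial_staircase_mem e)
  refine (Submodule.sub_mem_iff_left _ (Submodule.smul_of_tower_mem _ _ ?_)).1 h
  exact Submodule.mem_sup_right (Submodule.mem_span_singleton_self _)

lemma monomial_mem_pointSpan_of_staircase_le {a : Fin n →₀ ℕ} (ha : staircase n ≤ a) (r : ℚ) :
    monomial a r ∈ pointSpan n := by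
  obtain ⟨b, rfl⟩ := exists_add_of_le ha
  by_cases hb : b = 0
  · rw [hb, add_zero, ← mul_one r, ← smul_eq_mul, ← smul_monomial]
    exact Submodule.smul_mem _ _ (Submodule.mem_sup_right (Submodule.mem_span_singleton_self _))
  · obtain ⟨j, hj⟩ := Finsupp.ne_iff.1 hb
    refine mem_pointSpan_of_mem (Ideal.mem_of_dvd _ ?_ (X_mul_monomial_staircase_mem j))
    rw [← one_mul r, ← monomial_mul, mul_comm]
    exact mul_dvd_mul_left _ (X_dvd_monomial.2 (Or.inr hj))

lemma StrictMono.fin_val_le {a : Fin n → ℕ} (ha : StrictMono a) (i : Fin n) : (i : ℕ) ≤ a i := by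
  obtain ⟨i, hi⟩ := i
  induction i with
  | zero => exact Nat.zero_le _
  | succ i ih => exact (ih (by omega)).trans_lt (ha (Fin.mk_lt_mk.2 i.lt_succ_self))

lemma monomial_mem_pointSpan_of_injective {a : Fin n →₀ ℕ} (ha : Function.Injective a) (r : ℚ) :
    monomial a r ∈ pointSpan n := by
  set e := Tuple.sort a
  have hmono : StrictMono (a ∘ e) :=
    (Tuple.monotone_sort a).strictMono_of_injective (ha.comp e.injective)
  have h := rename_mem_pointSpan e
    (monomial_mem_pointSpan_of_staircase_le (a := a.mapDomain e.symm) (fun i => ?_) r)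
  · rw [rename_monomial, ← Finsupp.mapDomain_comp, Equiv.self_comp_symm,
      Finsupp.mapDomain_id] at h
    exact h
  · rw [← Finsupp.equivMapDomain_eq_mapDomain, Finsupp.equivMapDomain_apply, Equiv.symm_symm]
    exact hmono.fin_val_le i

lemma antisymmetrize_mem_pointSpan (f : MvPolynomial (Fin n) ℚ) :
    antisymmetrize f ∈ pointSpan n := by
  induction f using MvPolynomial.induction_on' with
  | monomial a r =>
    by_cases ha : Function.Injective a
    · rw [antisymmetrize_apply]
      exact sum_mem fun e _ => Submodule.smul_of_tower_mem _ _
        (rename_mem_pointSpan e (monomial_mem_pointSpan_of_injective ha r))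
    · simp only [Function.Injective, not_forall] at ha
      obtain ⟨i, j, haij, hij⟩ := ha
      rw [antisymmetrize_eq_zero hij]
      · exact zero_mem _
      · rw [rename_monomial, ← Finsupp.equivMapDomain_eq_mapDomain]
        refine congrArg (monomial · r) (Finsupp.ext fun k => ?_)
        rw [Finsupp.equivMapDomain_apply, Equiv.symm_swap, Equiv.swap_apply_def]
        split_ifs with h₁ h₂
        · rw [h₁, haij]
        · rw [h₂, haij]
        · rfl
  | add p q hp hq => rw [map_add]; exact add_mem hp hq

end Staircase

/-- Algebraic Poincaré duality for the coinvariant algebra: if c ∈ ℚ[x₁,…,xₙ]/S is killed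
by (the class of) every non-constant monomial, then c lies in the ℚ-span of the class of
the point ∏_{i=2}^n x_i^{i-1} (here x_{i+1} = X i, so the point class is ∏ᵢ X i ^ i). -/
theorem coinvariant_socle (n : ℕ)
    (c : MvPolynomial (Fin n) ℚ ⧸
        Ideal.span {p : MvPolynomial (Fin n) ℚ | p.IsSymmetric ∧ constantCoeff p = 0})
    (hc : ∀ d : Fin n →₀ ℕ, d ≠ 0 →
      c * Ideal.Quotient.mk _ (monomial d (1 : ℚ)) = 0) :
    c ∈ Submodule.span ℚ
      {Ideal.Quotient.mk
        (Ideal.span {p : MvPolynomial (Fin n) ℚ | p.IsSymmetric ∧ constantCoeff p = 0})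
        (∏ i : Fin n, X i ^ (i : ℕ))} := by
  obtain ⟨f, rfl⟩ := Ideal.Quotient.mk_surjective c
  have hf : ∀ i, X i * f ∈ symmetricIdeal (Fin n) := fun i => by
    have h := hc (Finsupp.single i 1) (by simp)
    rw [← map_mul, Ideal.Quotient.eq_zero_iff_mem, mul_comm] at h
    exact h
  have hmem : f ∈ pointSpan n := by
    have h := (Submodule.sub_mem_iff_right _ (antisymmetrize_mem_pointSpan f)).1
      (mem_pointSpan_of_mem (antisymmetrize_sub_factorial_smul_mem hf))
    rw [← Nat.cast_smul_eq_nsmul ℚ] at h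
    exact (Submodule.smul_mem_iff _ (Nat.cast_ne_zero.2 (Nat.factorial_ne_zero _))).1 h
  obtain ⟨a, ha, b, hb, rfl⟩ := Submodule.mem_sup.1 hmem
  obtain ⟨r, rfl⟩ := Submodule.mem_span_singleton.1 hb
  rw [map_add, Ideal.Quotient.eq_zero_iff_mem.2 ha, zero_add, monomial_staircase]
  exact Submodule.mem_span_singleton.2 ⟨r, rfl⟩
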